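/- There exist ε > 0, C > 1 and a natural number N such that for every n ≥ N the following holds. Let G be an n-vertex (p,β)-jumbled simple graph with δ(G) ≥ (1−ε)np, where p ≥ C·log(n)/n and β ≤ ε·np, let R ⊆ E(G) satisfy e_R(A,B) ≥ e_G(A,B)/2 for every partition V(G) = A ∪ B, and let S be a vertex set with |S| ≤ 2·log(n). Then for every vertex set X ⊆ V(G) with |X| ≤ n/2, the number of vertices outside X ∪ S joined by an edge of R to some vertex of X is at least min{10·|X|, n/7}. -/

import Mathlib

open SimpleGraph

/-- The number of edges of `G` with both endpoints inside `U`. -/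
noncomputable def interiorEdgeCount {V : Type} (G : SimpleGraph V) (U : Set V) : ℕ :=
  {e ∈ G.edgeSet | ∀ v ∈ e, v ∈ U}.ncard

/-- `G` is `(p, β)`-jumbled: `0 < p < 1 ≤ β` and for every vertex subset `U`,
`|e_G(U) - p * binom(|U|, 2)| ≤ β * |U|`. -/
def IsJumbled {V : Type} (G : SimpleGraph V) (p β : ℝ) : Prop :=
  0 < p ∧ p < 1 ∧ 1 ≤ β ∧
    ∀ U : Set V,
      |(interiorEdgeCount G U : ℝ) - p * (Nat.choose U.ncard 2 : ℕ)| ≤ β * U.ncard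

/-- The number of edges in the edge set `E` with one endpoint in `A` and the other in `B`. -/
noncomputable def edgeCountBetween {V : Type} (E : Set (Sym2 V)) (A B : Set V) : ℕ :=
  {e ∈ E | ∃ a ∈ A, ∃ b ∈ B, e = s(a, b)}.ncard

theorem card_filter_mk_eq_le_two {V : Type} [DecidableEq V] (P : Finset (V × V)) (e : Sym2 V) :
    (P.filter fun q => s(q.1, q.2) = e).card ≤ 2 := by
  induction e using Sym2.ind with
  | _ u v =>
    refine (Finset.card_le_card (t := {(u, v), (v, u)}) ?_).trans Finset.card_le_two
    rintro ⟨a, b⟩ h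
    have h := (Finset.mem_filter.1 h).2
    rw [Sym2.eq_iff] at h
    simpa using h

open Classical in
theorem sum_ncard_neighborSet_le {V : Type} [Fintype V] (G : SimpleGraph V) (X : Set V) :
    ∑ x ∈ X.toFinset, (G.neighborSet x).ncard ≤
      2 * interiorEdgeCount G X + edgeCountBetween G.edgeSet X Xᶜ := by
  let P : Finset (V × V) := X.toFinset.sigma (fun x => (G.neighborSet x).toFinset) |>.map
    (Equiv.sigmaEquivProd V V).toEmbedding
  have hP : ∀ q : V × V, q ∈ P ↔ q.1 ∈ X ∧ G.Adj q.1 q.2 := by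
    rintro ⟨a, b⟩
    simp [P]
  have hsum : ∑ x ∈ X.toFinset, (G.neighborSet x).ncard = P.card := by
    simp only [P, Finset.card_map, Finset.card_sigma, Set.ncard_eq_toFinset_card']
  rw [hsum, ← Finset.card_filter_add_card_filter_not (fun q : V × V => q.2 ∈ X)]
  refine Nat.add_le_add ?_ ?_
  · refine (Finset.card_le_mul_card_image (f := fun q : V × V => s(q.1, q.2)) _ 2
      (fun e _ => card_filter_mk_eq_le_two _ e)).trans (Nat.mul_le_mul_left 2 ?_)
    rw [← Set.ncard_coe_finset]
    refine Set.ncard_le_ncard ?_ (Set.toFinite _)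
    intro e he
    obtain ⟨⟨a, b⟩, hq, rfl⟩ := Finset.mem_image.1 (Finset.mem_coe.1 he)
    rw [Finset.mem_filter, hP] at hq
    refine ⟨hq.1.2, fun v hv => ?_⟩
    rcases Sym2.mem_iff.1 hv with rfl | rfl
    exacts [hq.1.1, hq.2]
  · have hinj : Set.InjOn (fun q : V × V => s(q.1, q.2))
        (P.filter fun q : V × V => q.2 ∉ X : Finset (V × V)) := by
      rintro ⟨a, b⟩ hq ⟨c, d⟩ hr h
      rw [Finset.mem_coe, Finset.mem_filter, hP] at hq hr
      rcases Sym2.eq_iff.1 h with ⟨rfl, rfl⟩ | ⟨rfl, rfl⟩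
      · rfl
      · exact absurd hq.1.1 hr.2
    rw [← Finset.card_image_of_injOn hinj, ← Set.ncard_coe_finset]
    refine Set.ncard_le_ncard ?_ (Set.toFinite _)
    intro e he
    obtain ⟨⟨a, b⟩, hq, rfl⟩ := Finset.mem_image.1 (Finset.mem_coe.1 he)
    rw [Finset.mem_filter, hP] at hq
    exact ⟨hq.1.2, a, hq.1.1, b, hq.2, rfl⟩

theorem edgeCountBetween_le_mul {V : Type} [Finite V] (E : Set (Sym2 V)) (A B : Set V) :
    edgeCountBetween E A B ≤ A.ncard * B.ncard := by
  rw [← Set.ncard_prod]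
  refine (Set.ncard_le_ncard (t := (fun q : V × V => s(q.1, q.2)) '' (A ×ˢ B)) ?_
    (Set.toFinite _)).trans (Set.ncard_image_le (Set.toFinite _))
  rintro e ⟨-, a, ha, b, hb, rfl⟩
  exact ⟨(a, b), ⟨ha, hb⟩, rfl⟩

theorem interiorEdgeCount_add_edgeCountBetween_le {V : Type} [Finite V] (G : SimpleGraph V)
    {A B : Set V} (h : Disjoint A B) :
    interiorEdgeCount G A + interiorEdgeCount G B + edgeCountBetween G.edgeSet A B ≤
      interiorEdgeCount G (A ∪ B) := by
  unfold interiorEdgeCount edgeCountBetween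
  have hAB := Set.disjoint_left.1 h
  rw [← Set.ncard_union_eq ?_ (Set.toFinite _) (Set.toFinite _),
    ← Set.ncard_union_eq ?_ (Set.toFinite _) (Set.toFinite _)]
  · refine Set.ncard_le_ncard ?_ (Set.toFinite _)
    rintro e ((⟨he, hA⟩ | ⟨he, hB⟩) | ⟨he, a, ha, b, hb, rfl⟩)
    · exact ⟨he, fun v hv => Or.inl (hA v hv)⟩
    · exact ⟨he, fun v hv => Or.inr (hB v hv)⟩
    · refine ⟨he, fun v hv => ?_⟩
      rcases Sym2.mem_iff.1 hv with rfl | rfl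
      exacts [Or.inl ha, Or.inr hb]
  · rw [Set.disjoint_left]
    rintro e (⟨-, hA⟩ | ⟨-, hB⟩) ⟨-, a, ha, b, hb, rfl⟩
    · exact hAB (hA b (Sym2.mem_mk_right a b)) hb
    · exact hAB ha (hB a (Sym2.mem_mk_left a b))
  · rw [Set.disjoint_left]
    rintro e ⟨-, hA⟩ ⟨-, hB⟩
    induction e using Sym2.ind with
    | _ u v => exact hAB (hA u (Sym2.mem_mk_left u v)) (hB u (Sym2.mem_mk_left u v))

theorem IsJumbled.edgeCountBetween_le {V : Type} [Finite V] {G : SimpleGraph V} {p β : ℝ}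
    (hG : IsJumbled G p β) {A B : Set V} (h : Disjoint A B) :
    (edgeCountBetween G.edgeSet A B : ℝ) ≤
      p * A.ncard * B.ncard + 2 * β * (A.ncard + B.ncard) := by
  have hle : (interiorEdgeCount G A + interiorEdgeCount G B + edgeCountBetween G.edgeSet A B : ℝ) ≤
      interiorEdgeCount G (A ∪ B) := mod_cast interiorEdgeCount_add_edgeCountBetween_le G h
  have hA := (abs_le.1 (hG.2.2.2 A)).1
  have hB := (abs_le.1 (hG.2.2.2 B)).1
  have hU := (abs_le.1 (hG.2.2.2 (A ∪ B))).2
  rw [Set.ncard_union_eq h (Set.toFinite _) (Set.toFinite _)] at hU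
  rw [Nat.cast_choose_two] at hA hB hU
  push_cast at hU
  linarith

theorem IsJumbled.le_edgeCountBetween_compl {V : Type} [Finite V] {G : SimpleGraph V} {p β d : ℝ}
    (hG : IsJumbled G p β) (hd : ∀ v, d ≤ (G.neighborSet v).ncard) (X : Set V) :
    X.ncard * (d - p * X.ncard - 2 * β) ≤ edgeCountBetween G.edgeSet X Xᶜ := by
  classical
  have := Fintype.ofFinite V
  have hsum : (X.ncard : ℝ) * d ≤ ∑ x ∈ X.toFinset, ((G.neighborSet x).ncard : ℝ) := by
    rw [Set.ncard_eq_toFinset_card', ← nsmul_eq_mul]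
    exact Finset.card_nsmul_le_sum _ _ _ fun x _ => hd x
  have hle : ∑ x ∈ X.toFinset, ((G.neighborSet x).ncard : ℝ) ≤
      2 * interiorEdgeCount G X + edgeCountBetween G.edgeSet X Xᶜ :=
    mod_cast (by convert sum_ncard_neighborSet_le G X)
  have hX := (abs_le.1 (hG.2.2.2 X)).2
  rw [Nat.cast_choose_two] at hX
  have hp : 0 ≤ p * X.ncard := mul_nonneg hG.1.le (Nat.cast_nonneg _)
  linarith

/-- All edges of `R` leaving `X` end in the outer neighbourhood of `X` avoiding `S`, or in `S`. -/
theorem edgeCountBetween_compl_le {V : Type} [Finite V] (G : SimpleGraph V) {R : Set (Sym2 V)}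
    (hR : R ⊆ G.edgeSet) (S X : Set V) :
    edgeCountBetween R X Xᶜ ≤
      edgeCountBetween G.edgeSet X {y | y ∉ X ∧ y ∉ S ∧ ∃ x ∈ X, s(x, y) ∈ R} +
        edgeCountBetween G.edgeSet X S := by
  refine (Set.ncard_le_ncard ?_ (Set.toFinite _)).trans (Set.ncard_union_le _ _)
  rintro e ⟨he, a, ha, b, hb, rfl⟩
  by_cases hS : b ∈ S
  · exact Or.inr ⟨hR he, a, ha, b, hS, rfl⟩
  · exact Or.inl ⟨hR he, a, ha, b, ⟨hb, hS, a, ha, he⟩, rfl⟩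

theorem expansion_of_set :
    ∃ ε C : ℝ, ε > 0 ∧ C > 1 ∧ ∃ N : ℕ, ∀ n : ℕ, n ≥ N →
      ∀ (V : Type) [Fintype V] [DecidableEq V] (G : SimpleGraph V) (p β : ℝ),
        Fintype.card V = n →
        p ≥ C * Real.log n / n → β ≤ ε * n * p →
        IsJumbled G p β →
        (∀ v : V, ((G.neighborSet v).ncard : ℝ) ≥ (1 - ε) * n * p) →
        ∀ R : Set (Sym2 V), R ⊆ G.edgeSet →
        (∀ A B : Set V, A ∪ B = Set.univ → Disjoint A B →
          (edgeCountBetween R A B : ℝ) ≥ (edgeCountBetween G.edgeSet A B : ℝ) / 2) →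
        ∀ S : Set V, (S.ncard : ℝ) ≤ 2 * Real.log n →
        ∀ X : Set V, (X.ncard : ℝ) ≤ n / 2 →
          ({y : V | y ∉ X ∧ y ∉ S ∧ ∃ x ∈ X, s(x, y) ∈ R}.ncard : ℝ) ≥
            min (10 * (X.ncard : ℝ)) (n / 7) := by
  refine ⟨1 / 1000, 100, by norm_num, by norm_num, 1, ?_⟩
  intro n hn V _ _ G p β _ hp hβ hG hdeg R hR hcut S hS X hX
  by_contra! hlt
  obtain ⟨hY₁, hY₂⟩ := lt_min_iff.1 hlt
  set Y : Set V := {y : V | y ∉ X ∧ y ∉ S ∧ ∃ x ∈ X, s(x, y) ∈ R}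
  have hdisj : Disjoint X Y := Set.disjoint_left.2 fun v hv hvY => hvY.1 hv
  have hn0 : (0 : ℝ) < n := Nat.cast_pos.2 hn
  have hY0 : (0 : ℝ) ≤ Y.ncard := Nat.cast_nonneg _
  have hx0 : (0 : ℝ) < X.ncard := by linarith
  have hp0 : 0 < p := hG.1
  have hlog : 100 * Real.log n ≤ n * p := by
    rw [ge_iff_le, div_le_iff₀ hn0] at hp
    linarith
  have hlow := hG.le_edgeCountBetween_compl hdeg X
  have hhalf := hcut X Xᶜ (Set.union_compl_self X) disjoint_compl_right
  have hup : (edgeCountBetween R X Xᶜ : ℝ) ≤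
      edgeCountBetween G.edgeSet X Y + edgeCountBetween G.edgeSet X S :=
    mod_cast edgeCountBetween_compl_le G hR S X
  have hXY := hG.edgeCountBetween_le hdisj
  have hXS : (edgeCountBetween G.edgeSet X S : ℝ) ≤ X.ncard * S.ncard :=
    mod_cast edgeCountBetween_le_mul G.edgeSet X S
  have hXS' : (edgeCountBetween G.edgeSet X S : ℝ) ≤ X.ncard * (n * p / 50) :=
    hXS.trans (mul_le_mul_of_nonneg_left (by linarith) hx0.le)
  have hmain : p * X.ncard * Y.ncard ≤ X.ncard * (n * p) / 7 := by
    have := mul_le_mul_of_nonneg_left hY₂.le (mul_pos hp0 hx0).le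
    linarith
  have herr : 2 * β * (X.ncard + Y.ncard) ≤ X.ncard * (n * p) * (22 / 1000) := by
    have h₁ := mul_le_mul_of_nonneg_left (by linarith : (X.ncard + Y.ncard : ℝ) ≤ 11 * X.ncard)
      (by linarith [hG.2.2.1] : 0 ≤ 2 * β)
    have h₂ := mul_le_mul_of_nonneg_right hβ hx0.le
    linarith
  have hcore : X.ncard * (n * p * (497 / 1000)) ≤
      X.ncard * ((1 - 1 / 1000) * n * p - p * X.ncard - 2 * β) := by
    refine mul_le_mul_of_nonneg_left ?_ hx0.le
    have := mul_le_mul_of_nonneg_left hX hp0.le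
    linarith
  have hpos : 0 < X.ncard * (n * p) := mul_pos hx0 (mul_pos hn0 hp0)
  linarith
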